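/- Correctness of the cumulative bidirectional system: if ⊢ Γ and Γ ⊢ t ▹ T is derivable in the cumulative bidirectional system, then Γ ⊢ t : T is derivable in the cumulative undirected system. -/

import Mathlib

/-! Formalization of CCω (terms, reduction, conversion, undirected and
bidirectional typing, cumulativity) using de Bruijn indices, following
Lennon-Bertrand, "Complete Bidirectional Typing for the Calculus of
Inductive Constructions". -/

namespace CComega

/-- Terms of CCω: `t ::= x | □_i | Πx:t.t | λx:t.t | t t`,
with variables as de Bruijn indices. -/
inductive Tm : Type
  | var : ℕ → Tm
  | sort : ℕ → Tm
  | pi : Tm → Tm → Tm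
  | lam : Tm → Tm → Tm
  | app : Tm → Tm → Tm
deriving DecidableEq

/-- `lift n k t` shifts by `n` the de Bruijn indices of `t` that are ≥ `k`. -/
def lift (n k : ℕ) : Tm → Tm
  | .var i => if i < k then .var i else .var (i + n)
  | .sort i => .sort i
  | .pi A B => .pi (lift n k A) (lift n (k + 1) B)
  | .lam A t => .lam (lift n k A) (lift n (k + 1) t)
  | .app t u => .app (lift n k t) (lift n k u)

/-- `subst u k t` is the capture-avoiding substitution `t[u/k]` of `u`
for de Bruijn index `k` in `t`. -/
def subst (u : Tm) (k : ℕ) : Tm → Tm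
  | .var i => if i < k then .var i else if i = k then lift k 0 u else .var (i - 1)
  | .sort i => .sort i
  | .pi A B => .pi (subst u k A) (subst u (k + 1) B)
  | .lam A t => .lam (subst u k A) (subst u (k + 1) t)
  | .app t v => .app (subst u k t) (subst u k v)

/-- One-step reduction `t → t'`: the least congruence such that
`(λx:A.t) u → t[u/x]`. -/
inductive Red : Tm → Tm → Prop
  | beta (A t u : Tm) : Red (.app (.lam A t) u) (subst u 0 t)
  | piDom {A A'} (B : Tm) : Red A A' → Red (.pi A B) (.pi A' B)
  | piCod (A : Tm) {B B'} : Red B B' → Red (.pi A B) (.pi A B')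
  | lamDom {A A'} (t : Tm) : Red A A' → Red (.lam A t) (.lam A' t)
  | lamBody (A : Tm) {t t'} : Red t t' → Red (.lam A t) (.lam A t')
  | appFun {t t'} (u : Tm) : Red t t' → Red (.app t u) (.app t' u)
  | appArg (t : Tm) {u u'} : Red u u' → Red (.app t u) (.app t u')

/-- Multi-step reduction `t ↠ t'`: reflexive-transitive closure of `→`. -/
def Reds : Tm → Tm → Prop := Relation.ReflTransGen Red

/-- Conversion `t ≡ u`: symmetric, reflexive, transitive closure of `→`. -/
def Conv : Tm → Tm → Prop := Relation.EqvGen Red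

/-- Contexts are lists of (de Bruijn) declarations, most recent first. -/
abbrev Ctx := List Tm

mutual
/-- Context well-formedness `⊢ Γ`. -/
inductive WfCtx : Ctx → Prop
  | nil : WfCtx []
  | cons {Γ A i} : WfCtx Γ → Typed Γ A (.sort i) → WfCtx (A :: Γ)

/-- Undirected typing `Γ ⊢ t : T`. -/
inductive Typed : Ctx → Tm → Tm → Prop
  | sort {Γ i} : WfCtx Γ → Typed Γ (.sort i) (.sort (i + 1))
  | var {Γ n A} : WfCtx Γ → Γ[n]? = some A → Typed Γ (.var n) (lift (n + 1) 0 A)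
  | pi {Γ A B i j} : Typed Γ A (.sort i) → Typed (A :: Γ) B (.sort j) →
      Typed Γ (.pi A B) (.sort (max i j))
  | lam {Γ A B t i} : Typed Γ (.pi A B) (.sort i) → Typed (A :: Γ) t B →
      Typed Γ (.lam A t) (.pi A B)
  | app {Γ t u A B} : Typed Γ t (.pi A B) → Typed Γ u A →
      Typed Γ (.app t u) (subst u 0 B)
  | conv {Γ t A B i} : Typed Γ t A → Typed Γ B (.sort i) → Conv A B →
      Typed Γ t B
end

mutual
/-- Bidirectional inference `Γ ⊢ t ▹ T`. -/
inductive Infer : Ctx → Tm → Tm → Prop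
  | sort {Γ i} : Infer Γ (.sort i) (.sort (i + 1))
  | var {Γ n A} : Γ[n]? = some A → Infer Γ (.var n) (lift (n + 1) 0 A)
  | pi {Γ A B i j} : InferSort Γ A (.sort i) → InferSort (A :: Γ) B (.sort j) →
      Infer Γ (.pi A B) (.sort (max i j))
  | lam {Γ A t B i} : InferSort Γ A (.sort i) → Infer (A :: Γ) t B →
      Infer Γ (.lam A t) (.pi A B)
  | app {Γ t u A B} : InferPi Γ t (.pi A B) → Check Γ u A →
      Infer Γ (.app t u) (subst u 0 B)

/-- Bidirectional checking `Γ ⊢ t ◃ T`. -/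
inductive Check : Ctx → Tm → Tm → Prop
  | check {Γ t T T'} : Infer Γ t T' → Conv T' T → Check Γ t T

/-- Constrained inference `Γ ⊢ t ▹_□ T` (the output is a universe). -/
inductive InferSort : Ctx → Tm → Tm → Prop
  | inferSort {Γ t T i} : Infer Γ t T → Reds T (.sort i) → InferSort Γ t (.sort i)

/-- Constrained inference `Γ ⊢ t ▹_Π T` (the output is a product type). -/
inductive InferPi : Ctx → Tm → Tm → Prop
  | inferPi {Γ t T A B} : Infer Γ t T → Reds T (.pi A B) → InferPi Γ t (.pi A B)
end

/-- Weak-head reduction `t ⇝ t'`: reduction only at the head. -/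
inductive WhRed : Tm → Tm → Prop
  | beta (A t u : Tm) : WhRed (.app (.lam A t) u) (subst u 0 t)
  | appFun {t t'} (u : Tm) : WhRed t t' → WhRed (.app t u) (.app t' u)

/-- Multi-step weak-head reduction `t ⇝* t'`. -/
def WhReds : Tm → Tm → Prop := Relation.ReflTransGen WhRed

mutual
/-- Weak-head bidirectional inference: as `Infer`, but constrained inference
uses weak-head reduction. -/
inductive InferW : Ctx → Tm → Tm → Prop
  | sort {Γ i} : InferW Γ (.sort i) (.sort (i + 1))
  | var {Γ n A} : Γ[n]? = some A → InferW Γ (.var n) (lift (n + 1) 0 A)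
  | pi {Γ A B i j} : InferSortW Γ A (.sort i) → InferSortW (A :: Γ) B (.sort j) →
      InferW Γ (.pi A B) (.sort (max i j))
  | lam {Γ A t B i} : InferSortW Γ A (.sort i) → InferW (A :: Γ) t B →
      InferW Γ (.lam A t) (.pi A B)
  | app {Γ t u A B} : InferPiW Γ t (.pi A B) → CheckW Γ u A →
      InferW Γ (.app t u) (subst u 0 B)

/-- Weak-head bidirectional checking. -/
inductive CheckW : Ctx → Tm → Tm → Prop
  | check {Γ t T T'} : InferW Γ t T' → Conv T' T → CheckW Γ t T

/-- Weak-head constrained inference `Γ ⊢ t ▹_□ T`. -/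
inductive InferSortW : Ctx → Tm → Tm → Prop
  | inferSort {Γ t T i} : InferW Γ t T → WhReds T (.sort i) →
      InferSortW Γ t (.sort i)

/-- Weak-head constrained inference `Γ ⊢ t ▹_Π T`. -/
inductive InferPiW : Ctx → Tm → Tm → Prop
  | inferPi {Γ t T A B} : InferW Γ t T → WhReds T (.pi A B) →
      InferPiW Γ t (.pi A B)
end

/-- Cumulativity `t ≼ u`: the least transitive relation containing conversion
such that `□_i ≼ □_j` whenever `i ≤ j` and `Πx:A.B ≼ Πx:A'.B'` whenever
`A ≡ A'` and `B ≼ B'`. -/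
inductive Cum : Tm → Tm → Prop
  | ofConv {t u} : Conv t u → Cum t u
  | sort {i j : ℕ} : i ≤ j → Cum (.sort i) (.sort j)
  | pi {A A' B B'} : Conv A A' → Cum B B' → Cum (.pi A B) (.pi A' B')
  | trans {t u v} : Cum t u → Cum u v → Cum t v

mutual
/-- Context well-formedness for the cumulative undirected system. -/
inductive WfCtxC : Ctx → Prop
  | nil : WfCtxC []
  | cons {Γ A i} : WfCtxC Γ → TypedC Γ A (.sort i) → WfCtxC (A :: Γ)

/-- Cumulative undirected typing `Γ ⊢ t : T`: as `Typed`, with the conversion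
rule replaced by cumulativity. -/
inductive TypedC : Ctx → Tm → Tm → Prop
  | sort {Γ i} : WfCtxC Γ → TypedC Γ (.sort i) (.sort (i + 1))
  | var {Γ n A} : WfCtxC Γ → Γ[n]? = some A → TypedC Γ (.var n) (lift (n + 1) 0 A)
  | pi {Γ A B i j} : TypedC Γ A (.sort i) → TypedC (A :: Γ) B (.sort j) →
      TypedC Γ (.pi A B) (.sort (max i j))
  | lam {Γ A B t i} : TypedC Γ (.pi A B) (.sort i) → TypedC (A :: Γ) t B →
      TypedC Γ (.lam A t) (.pi A B)
  | app {Γ t u A B} : TypedC Γ t (.pi A B) → TypedC Γ u A →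
      TypedC Γ (.app t u) (subst u 0 B)
  | cumul {Γ t A B i} : TypedC Γ t A → TypedC Γ B (.sort i) → Cum A B →
      TypedC Γ t B
end

mutual
/-- Cumulative bidirectional inference `Γ ⊢ t ▹ T`. -/
inductive InferC : Ctx → Tm → Tm → Prop
  | sort {Γ i} : InferC Γ (.sort i) (.sort (i + 1))
  | var {Γ n A} : Γ[n]? = some A → InferC Γ (.var n) (lift (n + 1) 0 A)
  | pi {Γ A B i j} : InferSortC Γ A (.sort i) → InferSortC (A :: Γ) B (.sort j) →
      InferC Γ (.pi A B) (.sort (max i j))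
  | lam {Γ A t B i} : InferSortC Γ A (.sort i) → InferC (A :: Γ) t B →
      InferC Γ (.lam A t) (.pi A B)
  | app {Γ t u A B} : InferPiC Γ t (.pi A B) → CheckC Γ u A →
      InferC Γ (.app t u) (subst u 0 B)

/-- Cumulative bidirectional checking `Γ ⊢ t ◃ T`, using cumulativity. -/
inductive CheckC : Ctx → Tm → Tm → Prop
  | check {Γ t T T'} : InferC Γ t T' → Cum T' T → CheckC Γ t T

/-- Cumulative constrained inference `Γ ⊢ t ▹_□ T` (unchanged: uses reduction). -/
inductive InferSortC : Ctx → Tm → Tm → Prop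
  | inferSort {Γ t T i} : InferC Γ t T → Reds T (.sort i) → InferSortC Γ t (.sort i)

/-- Cumulative constrained inference `Γ ⊢ t ▹_Π T` (unchanged: uses reduction). -/
inductive InferPiC : Ctx → Tm → Tm → Prop
  | inferPi {Γ t T A B} : InferC Γ t T → Reds T (.pi A B) → InferPiC Γ t (.pi A B)
end

/-! ### Parallel renamings and substitutions -/

/-- Extension of a renaming under a binder. -/
def upRen (ξ : ℕ → ℕ) : ℕ → ℕ
  | 0 => 0
  | n + 1 => ξ n + 1

/-- Application of a renaming to a term. -/
def ren (ξ : ℕ → ℕ) : Tm → Tm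
  | .var i => .var (ξ i)
  | .sort i => .sort i
  | .pi A B => .pi (ren ξ A) (ren (upRen ξ) B)
  | .lam A t => .lam (ren ξ A) (ren (upRen ξ) t)
  | .app t u => .app (ren ξ t) (ren ξ u)

/-- Extension of a parallel substitution under a binder. -/
def up (σ : ℕ → Tm) : ℕ → Tm
  | 0 => .var 0
  | n + 1 => ren Nat.succ (σ n)

/-- Application of a parallel substitution to a term. -/
def inst (σ : ℕ → Tm) : Tm → Tm
  | .var i => σ i
  | .sort i => .sort i
  | .pi A B => .pi (inst σ A) (inst (up σ) B)
  | .lam A t => .lam (inst σ A) (inst (up σ) t)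
  | .app t u => .app (inst σ t) (inst σ u)

/-- The parallel substitution replacing only the most recent variable. -/
def single (u : Tm) : ℕ → Tm
  | 0 => u
  | n + 1 => .var n

theorem up_var : up Tm.var = Tm.var := by
  funext n; cases n <;> rfl

theorem inst_var (t : Tm) : inst .var t = t := by
  induction t <;> simp_all [inst, up_var]

theorem ren_ren (t : Tm) (ξ ζ : ℕ → ℕ) : ren ζ (ren ξ t) = ren (ζ ∘ ξ) t := by
  have h : ∀ ξ ζ : ℕ → ℕ, upRen ζ ∘ upRen ξ = upRen (ζ ∘ ξ) := by
    intro ξ ζ; funext n; cases n <;> rfl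
  induction t generalizing ξ ζ <;> simp_all [ren]

theorem ren_eq_inst (t : Tm) (ξ : ℕ → ℕ) : ren ξ t = inst (Tm.var ∘ ξ) t := by
  have h : ∀ ξ : ℕ → ℕ, up (Tm.var ∘ ξ) = Tm.var ∘ upRen ξ := by
    intro ξ; funext n; cases n <;> rfl
  induction t generalizing ξ <;> simp_all [ren, inst]

theorem inst_ren (t : Tm) (ξ : ℕ → ℕ) (σ : ℕ → Tm) : inst σ (ren ξ t) = inst (σ ∘ ξ) t := by
  have h : ∀ (ξ : ℕ → ℕ) (σ : ℕ → Tm), up σ ∘ upRen ξ = up (σ ∘ ξ) := by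
    intro ξ σ; funext n; cases n <;> rfl
  induction t generalizing ξ σ <;> simp_all [ren, inst]

theorem ren_inst (t : Tm) (σ : ℕ → Tm) (ξ : ℕ → ℕ) :
    ren ξ (inst σ t) = inst (ren ξ ∘ σ) t := by
  have h : ∀ (σ : ℕ → Tm) (ξ : ℕ → ℕ), ren (upRen ξ) ∘ up σ = up (ren ξ ∘ σ) := by
    intro σ ξ; funext n
    cases n
    · rfl
    · simp only [Function.comp, up, ren_ren]; rfl
  induction t generalizing ξ σ <;> simp_all [ren, inst]

theorem inst_inst (t : Tm) (σ τ : ℕ → Tm) : inst τ (inst σ t) = inst (inst τ ∘ σ) t := by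
  have h : ∀ σ τ : ℕ → Tm, inst (up τ) ∘ up σ = up (inst τ ∘ σ) := by
    intro σ τ; funext n
    cases n
    · rfl
    · simp only [Function.comp, up, inst_ren, ren_inst]; rfl
  induction t generalizing σ τ <;> simp_all [inst]

theorem lift_eq_ren (n k : ℕ) (t : Tm) :
    lift n k t = ren (fun i => if i < k then i else i + n) t := by
  have h : ∀ k, upRen (fun i => if i < k then i else i + n) =
      fun i => if i < k + 1 then i else i + n := by
    intro k; funext i
    cases i with
    | zero => simp [upRen]
    | succ i => simp only [upRen]; split_ifs <;> omega
  induction t generalizing k with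
  | var i => simp only [lift, ren]; split_ifs <;> rfl
  | _ => simp_all [lift, ren]

theorem lift_zero_eq_ren (n : ℕ) (t : Tm) : lift n 0 t = ren (· + n) t := by
  simp [lift_eq_ren]

theorem subst_eq_inst (u : Tm) (k : ℕ) (t : Tm) : subst u k t =
    inst (fun i => if i < k then .var i else if i = k then lift k 0 u else .var (i - 1)) t := by
  have h : ∀ k, up (fun i => if i < k then Tm.var i else if i = k then lift k 0 u
      else .var (i - 1)) =
      fun i => if i < k + 1 then Tm.var i else if i = k + 1 then lift (k + 1) 0 u
        else .var (i - 1) := by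
    intro k; funext i
    cases i with
    | zero => simp [up]
    | succ i =>
      simp only [up, Nat.add_lt_add_iff_right, Nat.add_right_cancel_iff, lift_zero_eq_ren]
      split_ifs with h1 h2
      · rfl
      · simp only [ren_ren]; rfl
      · simp only [ren]; congr 1; omega
  induction t generalizing k with
  | var i => rfl
  | _ => simp_all [subst, inst]

theorem subst_zero_eq_inst (u t : Tm) : subst u 0 t = inst (single u) t := by
  rw [subst_eq_inst]
  congr 1; funext i
  cases i with
  | zero => simp [single, lift_zero_eq_ren, ren_eq_inst]; exact inst_var u
  | succ i => simp [single]

theorem inst_subst_zero (σ : ℕ → Tm) (u t : Tm) :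
    inst σ (subst u 0 t) = subst (inst σ u) 0 (inst (up σ) t) := by
  simp only [subst_zero_eq_inst, inst_inst]
  congr 1; funext i
  cases i with
  | zero => rfl
  | succ i =>
    simp only [Function.comp, single, up, inst, inst_ren]
    exact (inst_var _).symm

theorem ren_subst_zero (ξ : ℕ → ℕ) (u t : Tm) :
    ren ξ (subst u 0 t) = subst (ren ξ u) 0 (ren (upRen ξ) t) := by
  have h : up (Tm.var ∘ ξ) = Tm.var ∘ upRen ξ := by
    funext n; cases n <;> rfl
  simp only [ren_eq_inst, inst_subst_zero, h]

/-! ### Multi-step reduction and conversion -/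

theorem Red.inst {t t' : Tm} (h : Red t t') (σ : ℕ → Tm) :
    Red (inst σ t) (inst σ t') := by
  induction h generalizing σ with
  | beta A t u => rw [inst_subst_zero]; exact .beta _ _ _
  | piDom B _ ih => exact .piDom _ (ih _)
  | piCod A _ ih => exact .piCod _ (ih _)
  | lamDom t _ ih => exact .lamDom _ (ih _)
  | lamBody A _ ih => exact .lamBody _ (ih _)
  | appFun u _ ih => exact .appFun _ (ih _)
  | appArg t _ ih => exact .appArg _ (ih _)

theorem Reds.map {t u : Tm} (h : Reds t u) (f : Tm → Tm)
    (hf : ∀ {a b}, Red a b → Red (f a) (f b)) : Reds (f t) (f u) := by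
  induction h with
  | refl => exact .refl
  | tail _ h ih => exact ih.tail (hf h)

theorem Reds.pi {A A' B B' : Tm} (hA : Reds A A') (hB : Reds B B') :
    Reds (.pi A B) (.pi A' B') :=
  Relation.ReflTransGen.trans (hA.map (Tm.pi · B) (.piDom B)) (hB.map (Tm.pi A') (.piCod A'))

theorem Reds.lam {A A' t t' : Tm} (hA : Reds A A') (ht : Reds t t') :
    Reds (.lam A t) (.lam A' t') :=
  Relation.ReflTransGen.trans (hA.map (Tm.lam · t) (.lamDom t)) (ht.map (Tm.lam A') (.lamBody A'))

theorem Reds.app {t t' u u' : Tm} (ht : Reds t t') (hu : Reds u u') :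
    Reds (.app t u) (.app t' u') :=
  Relation.ReflTransGen.trans (ht.map (Tm.app · u) (.appFun u)) (hu.map (Tm.app t') (.appArg t'))

theorem Reds.ren {t t' : Tm} (h : Reds t t') (ξ : ℕ → ℕ) : Reds (ren ξ t) (ren ξ t') := by
  simp only [ren_eq_inst]
  exact h.map _ fun h => h.inst _

theorem Reds.inst_pointwise {σ τ : ℕ → Tm} (h : ∀ n, Reds (σ n) (τ n)) (t : Tm) :
    Reds (inst σ t) (inst τ t) := by
  have hup : ∀ {σ τ : ℕ → Tm}, (∀ n, Reds (σ n) (τ n)) → ∀ n, Reds (up σ n) (up τ n) := by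
    intro σ τ h n
    cases n with
    | zero => exact .refl
    | succ n => exact (h n).ren _
  induction t generalizing σ τ with
  | var i => exact h i
  | sort i => exact .refl
  | pi A B ihA ihB => exact (ihA h).pi (ihB (hup h))
  | lam A t ihA iht => exact (ihA h).lam (iht (hup h))
  | app t u iht ihu => exact (iht h).app (ihu h)

theorem Reds.conv {t u : Tm} (h : Reds t u) : Conv t u := by
  induction h with
  | refl => exact .refl _
  | tail _ h ih => exact .trans _ _ _ ih (.rel _ _ h)

theorem Conv.inst {t u : Tm} (h : Conv t u) (σ : ℕ → Tm) :
    Conv (inst σ t) (inst σ u) := by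
  induction h with
  | rel _ _ h => exact .rel _ _ (h.inst σ)
  | refl => exact .refl _
  | symm _ _ _ ih => exact .symm _ _ ih
  | trans _ _ _ _ _ ih₁ ih₂ => exact .trans _ _ _ ih₁ ih₂

theorem Cum.inst {t u : Tm} (h : Cum t u) (σ : ℕ → Tm) :
    Cum (inst σ t) (inst σ u) := by
  induction h generalizing σ with
  | ofConv h => exact .ofConv (h.inst σ)
  | sort h => exact .sort h
  | pi h _ ih => exact .pi (h.inst σ) (ih _)
  | trans _ _ ih₁ ih₂ => exact .trans (ih₁ σ) (ih₂ σ)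

theorem Cum.ren {t u : Tm} (h : Cum t u) (ξ : ℕ → ℕ) : Cum (ren ξ t) (ren ξ u) := by
  simp only [ren_eq_inst]; exact h.inst _

/-! ### Confluence -/

/-- Parallel reduction. -/
inductive Par : Tm → Tm → Prop
  | var (i : ℕ) : Par (.var i) (.var i)
  | sort (i : ℕ) : Par (.sort i) (.sort i)
  | pi {A A' B B'} : Par A A' → Par B B' → Par (.pi A B) (.pi A' B')
  | lam {A A' t t'} : Par A A' → Par t t' → Par (.lam A t) (.lam A' t')
  | app {t t' u u'} : Par t t' → Par u u' → Par (.app t u) (.app t' u')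
  | beta (A : Tm) {t t' u u'} : Par t t' → Par u u' →
      Par (.app (.lam A t) u) (subst u' 0 t')

theorem Par.refl (t : Tm) : Par t t := by
  induction t with
  | var i => exact .var i
  | sort i => exact .sort i
  | pi _ _ ihA ihB => exact .pi ihA ihB
  | lam _ _ ihA iht => exact .lam ihA iht
  | app _ _ iht ihu => exact .app iht ihu

theorem Par.ren {t t' : Tm} (h : Par t t') (ξ : ℕ → ℕ) : Par (ren ξ t) (ren ξ t') := by
  induction h generalizing ξ with
  | var i => exact .refl _
  | sort i => exact .refl _
  | pi _ _ ihA ihB => exact .pi (ihA _) (ihB _)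
  | lam _ _ ihA iht => exact .lam (ihA _) (iht _)
  | app _ _ iht ihu => exact .app (iht _) (ihu _)
  | beta A _ _ iht ihu => rw [ren_subst_zero]; exact .beta _ (iht _) (ihu _)

theorem Par.inst {t t' : Tm} (h : Par t t') {σ τ : ℕ → Tm} (hσ : ∀ n, Par (σ n) (τ n)) :
    Par (inst σ t) (inst τ t') := by
  have hup : ∀ {σ τ : ℕ → Tm}, (∀ n, Par (σ n) (τ n)) → ∀ n, Par (up σ n) (up τ n) := by
    intro σ τ h n
    cases n with
    | zero => exact .refl _
    | succ n => exact (h n).ren _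
  induction h generalizing σ τ with
  | var i => exact hσ i
  | sort i => exact .refl _
  | pi _ _ ihA ihB => exact .pi (ihA hσ) (ihB (hup hσ))
  | lam _ _ ihA iht => exact .lam (ihA hσ) (iht (hup hσ))
  | app _ _ iht ihu => exact .app (iht hσ) (ihu hσ)
  | beta A _ _ iht ihu => rw [inst_subst_zero]; exact .beta _ (iht (hup hσ)) (ihu hσ)

theorem Par.subst_zero {t t' u u' : Tm} (ht : Par t t') (hu : Par u u') :
    Par (subst u 0 t) (subst u' 0 t') := by
  simp only [subst_zero_eq_inst]
  refine ht.inst fun n => ?_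
  cases n with
  | zero => exact hu
  | succ n => exact .refl _

theorem Red.par {t u : Tm} (h : Red t u) : Par t u := by
  induction h with
  | beta A t u => exact .beta A (.refl t) (.refl u)
  | piDom B _ ih => exact .pi ih (.refl _)
  | piCod A _ ih => exact .pi (.refl _) ih
  | lamDom t _ ih => exact .lam ih (.refl _)
  | lamBody A _ ih => exact .lam (.refl _) ih
  | appFun u _ ih => exact .app ih (.refl _)
  | appArg t _ ih => exact .app (.refl _) ih

theorem Par.reds {t u : Tm} (h : Par t u) : Reds t u := by
  induction h with
  | var i => exact .refl
  | sort i => exact .refl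
  | pi _ _ ihA ihB => exact ihA.pi ihB
  | lam _ _ ihA iht => exact ihA.lam iht
  | app _ _ iht ihu => exact iht.app ihu
  | beta A _ _ iht ihu =>
    exact (Reds.app (Reds.lam .refl iht) ihu).tail (.beta _ _ _)

/-- Complete development: contraction of all redexes of a term. -/
def dev : Tm → Tm
  | .var i => .var i
  | .sort i => .sort i
  | .pi A B => .pi (dev A) (dev B)
  | .lam A t => .lam (dev A) (dev t)
  | .app (.lam _ t) u => subst (dev u) 0 (dev t)
  | .app t u => .app (dev t) (dev u)

theorem Par.dev {t u : Tm} (h : Par t u) : Par u (dev t) := by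
  induction h with
  | var i => exact .var i
  | sort i => exact .sort i
  | pi _ _ ihA ihB => exact .pi ihA ihB
  | lam _ _ ihA iht => exact .lam ihA iht
  | beta A _ _ iht ihu => exact iht.subst_zero ihu
  | @app t t' u u' ht _ iht ihu =>
    cases t with
    | lam A s =>
      cases ht with
      | lam hA hs =>
        cases iht with
        | lam _ hs' => exact .beta _ hs' ihu
    | _ => exact .app iht ihu

theorem Reds.confluent {t u v : Tm} (hu : Reds t u) (hv : Reds t v) :
    ∃ w, Reds u w ∧ Reds v w := by
  have toPar : ∀ {a b}, Reds a b → Relation.ReflTransGen Par a b := by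
    intro a b h
    induction h with
    | refl => exact .refl
    | tail _ h ih => exact ih.tail h.par
  have ofPar : ∀ {a b}, Relation.ReflTransGen Par a b → Reds a b := by
    intro a b h
    induction h with
    | refl => exact .refl
    | tail _ h ih => exact Relation.ReflTransGen.trans ih h.reds
  obtain ⟨w, h₁, h₂⟩ := Relation.church_rosser
    (fun a _ _ hb hc => ⟨dev a, .single hb.dev, .single hc.dev⟩) (toPar hu) (toPar hv)
  exact ⟨w, ofPar h₁, ofPar h₂⟩

theorem Conv.join {t u : Tm} (h : Conv t u) : ∃ w, Reds t w ∧ Reds u w := by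
  induction h with
  | rel _ _ h => exact ⟨_, .single h, .refl⟩
  | refl => exact ⟨_, .refl, .refl⟩
  | symm _ _ _ ih => obtain ⟨w, h₁, h₂⟩ := ih; exact ⟨w, h₂, h₁⟩
  | trans _ _ _ _ _ ih₁ ih₂ =>
    obtain ⟨w₁, h₁, h₂⟩ := ih₁
    obtain ⟨w₂, h₃, h₄⟩ := ih₂
    obtain ⟨w, h₅, h₆⟩ := h₂.confluent h₃
    exact ⟨w, Relation.ReflTransGen.trans h₁ h₅, Relation.ReflTransGen.trans h₄ h₆⟩

theorem Reds.pi_inv {A B T : Tm} (h : Reds (.pi A B) T) :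
    ∃ A' B', T = .pi A' B' ∧ Reds A A' ∧ Reds B B' := by
  induction h with
  | refl => exact ⟨A, B, rfl, .refl, .refl⟩
  | tail _ h ih =>
    obtain ⟨A', B', rfl, hA, hB⟩ := ih
    cases h with
    | piDom _ h => exact ⟨_, _, rfl, hA.tail h, hB⟩
    | piCod _ h => exact ⟨_, _, rfl, hA, hB.tail h⟩

theorem Cum.reds_pi {T U : Tm} (h : Cum T U) {A B : Tm} (hT : Reds T (.pi A B)) :
    ∃ A' B', Reds U (.pi A' B') ∧ Conv A A' ∧ Cum B B' := by
  induction h generalizing A B with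
  | ofConv h =>
    obtain ⟨w, h₁, h₂⟩ := h.join
    obtain ⟨v, h₃, h₄⟩ := h₁.confluent hT
    obtain ⟨A', B', rfl, hA, hB⟩ := h₄.pi_inv
    exact ⟨A', B', Relation.ReflTransGen.trans h₂ h₃, hA.conv, .ofConv hB.conv⟩
  | sort _ =>
    rcases Relation.ReflTransGen.cases_head hT with h | ⟨_, h, _⟩
    · cases h
    · cases h
  | pi hA hB _ =>
    obtain ⟨_, _, h, hA', hB'⟩ := hT.pi_inv
    cases h
    exact ⟨_, _, .refl, .trans _ _ _ (.symm _ _ hA'.conv) hA,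
      .trans (.ofConv (.symm _ _ hB'.conv)) hB⟩
  | trans _ _ ih₁ ih₂ =>
    obtain ⟨_, _, h₁, hA₁, hB₁⟩ := ih₁ hT
    obtain ⟨_, _, h₂, hA₂, hB₂⟩ := ih₂ h₁
    exact ⟨_, _, h₂, .trans _ _ _ hA₁ hA₂, .trans hB₁ hB₂⟩

theorem Cum.pi_injective {A A' B B' : Tm} (h : Cum (.pi A B) (.pi A' B')) :
    Conv A A' ∧ Cum B B' := by
  obtain ⟨_, _, h, hA, hB⟩ := h.reds_pi .refl
  obtain ⟨_, _, e, hA', hB'⟩ := h.pi_inv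
  cases e
  exact ⟨.trans _ _ _ hA (.symm _ _ hA'.conv), .trans hB (.ofConv (.symm _ _ hB'.conv))⟩

/-! ### Metatheory of the cumulative undirected system -/

theorem TypedC.induct {motive : ∀ Γ t T, TypedC Γ t T → Prop}
    (sort : ∀ {Γ i} (h : WfCtxC Γ), motive Γ (.sort i) (.sort (i + 1)) (.sort h))
    (var : ∀ {Γ : Ctx} {n A} (h : WfCtxC Γ) (hn : Γ[n]? = some A),
      motive Γ (.var n) (lift (n + 1) 0 A) (.var h hn))
    (pi : ∀ {Γ A B i j} (hA : TypedC Γ A (.sort i)) (hB : TypedC (A :: Γ) B (.sort j)),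
      motive Γ A (.sort i) hA → motive (A :: Γ) B (.sort j) hB →
      motive Γ (.pi A B) (.sort (max i j)) (.pi hA hB))
    (lam : ∀ {Γ A B t i} (hP : TypedC Γ (.pi A B) (.sort i)) (ht : TypedC (A :: Γ) t B),
      motive Γ (.pi A B) (.sort i) hP → motive (A :: Γ) t B ht →
      motive Γ (.lam A t) (.pi A B) (.lam hP ht))
    (app : ∀ {Γ t u A B} (ht : TypedC Γ t (.pi A B)) (hu : TypedC Γ u A),
      motive Γ t (.pi A B) ht → motive Γ u A hu →
      motive Γ (.app t u) (subst u 0 B) (.app ht hu))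
    (cumul : ∀ {Γ t A B i} (ht : TypedC Γ t A) (hB : TypedC Γ B (.sort i)) (hc : Cum A B),
      motive Γ t A ht → motive Γ B (.sort i) hB → motive Γ t B (.cumul ht hB hc))
    {Γ : Ctx} {t T : Tm} (h : TypedC Γ t T) : motive Γ t T h :=
  TypedC.rec (motive_1 := fun _ _ => True) (motive_2 := motive)
    trivial (fun _ _ _ _ => trivial) (fun h _ => sort h) (fun h e _ => var h e)
    pi lam app cumul h

theorem TypedC.wf {Γ : Ctx} {t T : Tm} (h : TypedC Γ t T) : WfCtxC Γ := by
  induction h using TypedC.induct <;> assumption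

theorem TypedC.pi_inv {Γ : Ctx} {A B T : Tm} (h : TypedC Γ (.pi A B) T) :
    ∃ i j, TypedC Γ A (.sort i) ∧ TypedC (A :: Γ) B (.sort j) := by
  generalize e : Tm.pi A B = t at h
  induction h using TypedC.induct with
  | pi hA hB => cases e; exact ⟨_, _, hA, hB⟩
  | cumul _ _ _ ih => exact ih e
  | _ => cases e

theorem TypedC.lam_inv {Γ : Ctx} {A t T : Tm} (h : TypedC Γ (.lam A t) T) :
    ∃ B i, TypedC Γ (.pi A B) (.sort i) ∧ TypedC (A :: Γ) t B ∧ Cum (.pi A B) T := by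
  generalize e : Tm.lam A t = s at h
  induction h using TypedC.induct with
  | lam hP ht => cases e; exact ⟨_, _, hP, ht, .ofConv (.refl _)⟩
  | cumul _ _ hc ih =>
    obtain ⟨B, i, hP, ht, hc'⟩ := ih e
    exact ⟨B, i, hP, ht, .trans hc' hc⟩
  | _ => cases e

theorem TypedC.ren {Γ : Ctx} {t T : Tm} (h : TypedC Γ t T) {Δ : Ctx} {ξ : ℕ → ℕ}
    (hΔ : WfCtxC Δ) (hξ : ∀ {n A}, Γ[n]? = some A → ∃ A', Δ[ξ n]? = some A' ∧
      lift (ξ n + 1) 0 A' = ren ξ (lift (n + 1) 0 A)) :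
    TypedC Δ (ren ξ t) (ren ξ T) := by
  have hup : ∀ {Γ Δ : Ctx} {ξ : ℕ → ℕ} (A₀ : Tm),
      (∀ {n A}, Γ[n]? = some A → ∃ A', Δ[ξ n]? = some A' ∧
        lift (ξ n + 1) 0 A' = CComega.ren ξ (lift (n + 1) 0 A)) →
      ∀ {n A}, (A₀ :: Γ)[n]? = some A →
        ∃ A', (CComega.ren ξ A₀ :: Δ)[upRen ξ n]? = some A' ∧
          lift (upRen ξ n + 1) 0 A' = CComega.ren (upRen ξ) (lift (n + 1) 0 A) := by
    intro Γ Δ ξ A₀ hξ n A hn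
    cases n with
    | zero =>
      cases hn
      refine ⟨_, rfl, ?_⟩
      simp only [lift_zero_eq_ren, ren_ren]; rfl
    | succ n =>
      obtain ⟨A', hA', e⟩ := hξ hn
      refine ⟨A', hA', ?_⟩
      have e' := congrArg (CComega.ren Nat.succ) e
      simp only [lift_zero_eq_ren, ren_ren] at e' ⊢
      exact e'
  induction h using TypedC.induct generalizing Δ ξ with
  | sort _ => exact .sort hΔ
  | var _ hn =>
    obtain ⟨A', hA', e⟩ := hξ hn
    rw [← e]; exact .var hΔ hA'
  | pi _ _ ihA ihB =>
    have hA := ihA hΔ hξ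
    exact .pi hA (ihB (.cons hΔ hA) (hup _ hξ))
  | lam _ _ ihP iht =>
    have hP := ihP hΔ hξ
    obtain ⟨_, _, hA, _⟩ := hP.pi_inv
    exact .lam hP (iht (.cons hΔ hA) (hup _ hξ))
  | app _ _ iht ihu =>
    rw [ren_subst_zero]; exact .app (iht hΔ hξ) (ihu hΔ hξ)
  | cumul _ _ hc iht ihB => exact .cumul (iht hΔ hξ) (ihB hΔ hξ) (hc.ren ξ)

theorem TypedC.weaken {Γ : Ctx} {t T A : Tm} (h : TypedC Γ t T) (hA : WfCtxC (A :: Γ)) :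
    TypedC (A :: Γ) (CComega.ren Nat.succ t) (CComega.ren Nat.succ T) := by
  refine h.ren hA fun {n B} hn => ⟨B, hn, ?_⟩
  simp only [lift_zero_eq_ren, ren_ren]; rfl

theorem TypedC.inst {Γ : Ctx} {t T : Tm} (h : TypedC Γ t T) {Δ : Ctx} {σ : ℕ → Tm}
    (hΔ : WfCtxC Δ)
    (hσ : ∀ {n A}, Γ[n]? = some A → TypedC Δ (σ n) (inst σ (lift (n + 1) 0 A))) :
    TypedC Δ (inst σ t) (inst σ T) := by
  have hup : ∀ {Γ Δ : Ctx} {σ : ℕ → Tm} {A₀ : Tm}, WfCtxC (CComega.inst σ A₀ :: Δ) →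
      (∀ {n A}, Γ[n]? = some A → TypedC Δ (σ n) (CComega.inst σ (lift (n + 1) 0 A))) →
      ∀ {n A}, (A₀ :: Γ)[n]? = some A → TypedC (CComega.inst σ A₀ :: Δ) (up σ n)
        (CComega.inst (up σ) (lift (n + 1) 0 A)) := by
    intro Γ Δ σ A₀ hwf hσ n A hn
    cases n with
    | zero =>
      cases hn
      have := TypedC.var (n := 0) hwf rfl
      simp only [lift_zero_eq_ren, ren_inst, inst_ren] at this ⊢
      exact this
    | succ n =>
      have := (hσ hn).weaken hwf
      simp only [lift_zero_eq_ren, ren_inst, inst_ren] at this ⊢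
      exact this
  induction h using TypedC.induct generalizing Δ σ with
  | sort _ => exact .sort hΔ
  | var _ hn => exact hσ hn
  | pi _ _ ihA ihB =>
    have hA := ihA hΔ hσ
    exact .pi hA (ihB (.cons hΔ hA) (hup (.cons hΔ hA) hσ))
  | lam _ _ ihP iht =>
    have hP := ihP hΔ hσ
    obtain ⟨_, _, hA, _⟩ := hP.pi_inv
    exact .lam hP (iht (.cons hΔ hA) (hup (.cons hΔ hA) hσ))
  | app _ _ iht ihu =>
    rw [inst_subst_zero]; exact .app (iht hΔ hσ) (ihu hΔ hσ)
  | cumul _ _ hc iht ihB => exact .cumul (iht hΔ hσ) (ihB hΔ hσ) (hc.inst σ)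

theorem TypedC.subst_zero {Γ : Ctx} {t T u A : Tm} (ht : TypedC (A :: Γ) t T)
    (hu : TypedC Γ u A) : TypedC Γ (subst u 0 t) (subst u 0 T) := by
  simp only [subst_zero_eq_inst]
  refine ht.inst hu.wf fun {n B} hn => ?_
  cases n with
  | zero =>
    cases hn
    rw [lift_zero_eq_ren, inst_ren]
    exact (inst_var A).symm ▸ hu
  | succ n =>
    have h : TypedC Γ _ _ := .var hu.wf hn
    rw [lift_zero_eq_ren, ren_eq_inst] at h
    rw [lift_zero_eq_ren, inst_ren]
    exact h

theorem TypedC.ctx_conv {Γ : Ctx} {t T A A' : Tm} {i : ℕ} (ht : TypedC (A :: Γ) t T)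
    (hA : TypedC Γ A (.sort i)) (hwf : WfCtxC (A' :: Γ)) (hc : Conv A A') :
    TypedC (A' :: Γ) t T := by
  have h := ht.inst (σ := .var) hwf fun {n B} hn => by
    rw [inst_var]
    cases n with
    | zero =>
      cases hn
      have hA' := hA.weaken hwf
      rw [lift_zero_eq_ren]
      refine .cumul (.var (n := 0) hwf rfl) hA' ?_
      rw [lift_zero_eq_ren]
      exact Cum.ren (.ofConv (.symm _ _ hc)) _
    | succ n => exact .var hwf hn
  rwa [inst_var, inst_var] at h

theorem WfCtxC.lookup {Γ : Ctx} (hΓ : WfCtxC Γ) {n : ℕ} {A : Tm} (hn : Γ[n]? = some A) :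
    ∃ i, TypedC Γ (lift (n + 1) 0 A) (.sort i) := by
  induction Γ generalizing n with
  | nil => simp at hn
  | cons A₀ Γ ih =>
    obtain _ | ⟨hΓ', hA₀⟩ := id hΓ
    cases n with
    | zero =>
      cases hn
      rw [lift_zero_eq_ren]
      exact ⟨_, hA₀.weaken hΓ⟩
    | succ n =>
      obtain ⟨i, h⟩ := ih hΓ' hn
      refine ⟨i, ?_⟩
      have h' := h.weaken hΓ
      simp only [lift_zero_eq_ren, ren_ren] at h' ⊢
      exact h'

theorem TypedC.validity {Γ : Ctx} {t T : Tm} (h : TypedC Γ t T) :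
    ∃ i, TypedC Γ T (.sort i) := by
  induction h using TypedC.induct with
  | sort hΓ => exact ⟨_, .sort hΓ⟩
  | var hΓ hn => exact hΓ.lookup hn
  | pi hA _ _ _ => exact ⟨_, .sort hA.wf⟩
  | lam hP _ _ _ => exact ⟨_, hP⟩
  | app _ hu ih _ =>
    obtain ⟨_, hP⟩ := ih
    obtain ⟨_, j, _, hB⟩ := hP.pi_inv
    exact ⟨j, hB.subst_zero hu⟩
  | cumul _ hB _ _ _ => exact ⟨_, hB⟩

/-- Subject reduction. -/
theorem TypedC.red {Γ : Ctx} {t t' T : Tm} (h : TypedC Γ t T) (hr : Red t t') :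
    TypedC Γ t' T := by
  induction h using TypedC.induct generalizing t' with
  | sort _ => cases hr
  | var _ _ => cases hr
  | pi hA hB ihA ihB =>
    cases hr with
    | piDom _ hr =>
      have hA' := ihA hr
      exact .pi hA' (hB.ctx_conv hA (.cons hA.wf hA') (.rel _ _ hr))
    | piCod _ hr => exact .pi hA (ihB hr)
  | lam hP ht ihP iht =>
    cases hr with
    | lamDom _ hr =>
      have hP' := ihP (.piDom _ hr)
      obtain ⟨_, _, hA, _⟩ := hP.pi_inv
      obtain ⟨_, _, hA', _⟩ := hP'.pi_inv
      exact .cumul (.lam hP' (ht.ctx_conv hA (.cons hA.wf hA') (.rel _ _ hr))) hP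
        (.ofConv (.symm _ _ (.rel _ _ (.piDom _ hr))))
    | lamBody _ hr => exact .lam hP (iht hr)
  | @app Γ t u A B ht hu iht ihu =>
    obtain ⟨i, hB⟩ := (TypedC.app ht hu).validity
    cases hr with
    | beta A₀ s _ =>
      obtain ⟨B₀, _, hP, hs, hc⟩ := ht.lam_inv
      obtain ⟨_, _, hA₀, _⟩ := hP.pi_inv
      obtain ⟨hcA, hcB⟩ := hc.pi_injective
      have hu₀ := TypedC.cumul hu hA₀ (.ofConv (.symm _ _ hcA))
      refine .cumul (hs.subst_zero hu₀) hB ?_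
      simp only [subst_zero_eq_inst]
      exact hcB.inst _
    | appFun _ hr => exact .app (iht hr) hu
    | appArg _ hr =>
      refine .cumul (.app ht (ihu hr)) hB (.ofConv (.symm _ _ (Reds.conv ?_)))
      simp only [subst_zero_eq_inst]
      refine Reds.inst_pointwise (fun n => ?_) B
      cases n with
      | zero => exact .single hr
      | succ n => exact .refl
  | cumul _ hB hc iht _ => exact .cumul (iht hr) hB hc

theorem TypedC.reds {Γ : Ctx} {t t' T : Tm} (h : TypedC Γ t T) (hr : Reds t t') :
    TypedC Γ t' T := by
  induction hr with
  | refl => exact h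
  | tail _ hr ih => exact ih.red hr

/-- **Correctness of the cumulative bidirectional system.** If `⊢ Γ` and
`Γ ⊢ t ▹ T` (cumulative bidirectional), then `Γ ⊢ t : T` (cumulative undirected). -/
theorem inferC_correct {Γ : Ctx} {t T : Tm} (hΓ : WfCtxC Γ) (h : InferC Γ t T) :
    TypedC Γ t T := by
  refine InferC.rec
    (motive_1 := fun Γ t T _ => WfCtxC Γ → TypedC Γ t T)
    (motive_2 := fun Γ t T _ => WfCtxC Γ → ∀ i, TypedC Γ T (.sort i) → TypedC Γ t T)
    (motive_3 := fun Γ t T _ => WfCtxC Γ → TypedC Γ t T)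
    (motive_4 := fun Γ t T _ => WfCtxC Γ → TypedC Γ t T ∧ ∃ i, TypedC Γ T (.sort i))
    ?_ ?_ ?_ ?_ ?_ ?_ ?_ ?_ h hΓ
  · exact fun hΓ => .sort hΓ
  · exact fun hn hΓ => .var hΓ hn
  · exact fun _ _ ihA ihB hΓ => .pi (ihA hΓ) (ihB (.cons hΓ (ihA hΓ)))
  · intro Γ A t B i _ _ ihA iht hΓ
    have ht := iht (.cons hΓ (ihA hΓ))
    obtain ⟨_, hB⟩ := ht.validity
    exact .lam (.pi (ihA hΓ) hB) ht
  · intro Γ t u A B _ _ iht ihu hΓ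
    obtain ⟨ht, _, hP⟩ := iht hΓ
    obtain ⟨i, _, hA, _⟩ := hP.pi_inv
    exact .app ht (ihu hΓ i hA)
  · exact fun _ hc ih hΓ _ hT => .cumul (ih hΓ) hT hc
  · exact fun _ hr ih hΓ => .cumul (ih hΓ) (.sort hΓ) (.ofConv hr.conv)
  · intro Γ t T A B _ hr ih hΓ
    obtain ⟨i, hT⟩ := (ih hΓ).validity
    have hP := hT.reds hr
    exact ⟨.cumul (ih hΓ) hP (.ofConv hr.conv), i, hP⟩

end CComega
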